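/- Assume: μ is a strong limit singular cardinal with cf(μ) = ℵ₀; λ = 2^μ; κ ≤ λ; T is a tree with a root, with κ levels, with at most λ nodes (|T| ≤ λ); and the cardinality χ of the set of κ-branches of T satisfies χ > λ. Then there is a superatomic Boolean algebra B such that |B| = χ, |Atom(B)| = |T| + μ, and |T| + μ ≤ |Aut(B)| ≤ λ. -/

import Mathlib

open Cardinal

/-- A Boolean algebra is superatomic if every homomorphic image of it is atomic. -/
def Superatomic (B : Type) [BooleanAlgebra B] : Prop :=
  ∀ (C : Type) (_ : BooleanAlgebra C) (h : BoundedLatticeHom B C),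
    Function.Surjective h → IsAtomic C

/-- `T` is a tree with `κ` levels: it has a root (least element), the set of predecessors of
every node is well-ordered by `<`, and its order type (the level of the node) is `< κ.ord`. -/
def IsTreeWithLevels (T : Type) [PartialOrder T] (κ : Cardinal) : Prop :=
  (∃ r : T, ∀ t : T, r ≤ t) ∧
  ∀ t : T, ∃ hw : IsWellOrder (Set.Iio t) (· < ·),
    @Ordinal.type (Set.Iio t) (· < ·) hw < κ.ord

/-- A `κ`-branch of a tree `T`: a downward closed chain whose order type under `<` is `κ.ord`. -/
def IsKappaBranch (T : Type) [PartialOrder T] (κ : Cardinal) (b : Set T) : Prop :=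
  IsChain (· < ·) b ∧ (∀ s t : T, s < t → t ∈ b → s ∈ b) ∧
  ∃ hw : IsWellOrder b (· < ·), @Ordinal.type b (· < ·) hw = κ.ord

theorem Set.isWF_iff_exists_minimal {α : Type*} [PartialOrder α] {s : Set α} :
    s.IsWF ↔ ∀ t ⊆ s, t.Nonempty → ∃ m, Minimal (· ∈ t) m := by
  constructor
  · intro h t ht ⟨a, ha⟩
    obtain ⟨⟨m, hms⟩, hm, hmin⟩ := WellFounded.has_min (Set.IsWF.mono h ht)
      Set.univ ⟨⟨a, ha⟩, trivial⟩
    refine ⟨m, hms, fun y hy hle => ?_⟩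
    by_contra hn
    exact hmin ⟨y, hy⟩ trivial (lt_of_le_not_ge hle hn)
  · intro h
    refine Set.isWF_iff_no_descending_seq.2 fun f hf hfs => ?_
    obtain ⟨m, ⟨n, rfl⟩, hmin⟩ := h (Set.range f) (by rintro _ ⟨n, rfl⟩; exact hfs n)
      (Set.range_nonempty f)
    have hlt : f (n + 1) < f n := hf (Nat.lt_succ_self n)
    exact hlt.not_ge (hmin ⟨_, rfl⟩ hlt.le)

theorem superatomic_closure {α : Type} [BooleanAlgebra α] {G : Set α} (hinf : InfClosed G)
    (htop : ⊤ ∈ G) (hwf : G.IsWF) : Superatomic (BooleanSubalgebra.closure G) := by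
  intro C _ h hsurj
  constructor
  intro c
  refine or_iff_not_imp_left.2 fun hc => ?_
  let k : G → C := fun g => h ⟨g, BooleanSubalgebra.subset_closure g.2⟩
  obtain ⟨g, ⟨hgG, e, he0, hec, heg⟩, hmin⟩ := Set.isWF_iff_exists_minimal.1 hwf
    {g | ∃ hg : g ∈ G, ∃ e : C, e ≠ ⊥ ∧ e ≤ c ∧ e ≤ k ⟨g, hg⟩} (fun g hg => hg.1)
    ⟨⊤, htop, c, hc, le_rfl, by
      have : k ⟨⊤, htop⟩ = ⊤ := map_top h
      rw [this]; exact le_top⟩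
  have key : ∀ (x : α) (hx : x ∈ BooleanSubalgebra.closure G),
      e ≤ h ⟨x, hx⟩ ∨ e ⊓ h ⟨x, hx⟩ = ⊥ := by
    intro x hx
    induction hx using BooleanSubalgebra.closure_bot_sup_induction with
    | mem x hx =>
      refine or_iff_not_imp_right.2 fun hne => ?_
      have hle : g ≤ g ⊓ x := hmin ⟨hinf hgG hx, e ⊓ k ⟨x, hx⟩, hne, inf_le_left.trans hec, by
        have : k ⟨g ⊓ x, hinf hgG hx⟩ = k ⟨g, hgG⟩ ⊓ k ⟨x, hx⟩ :=
          map_inf h (⟨g, BooleanSubalgebra.subset_closure hgG⟩ : BooleanSubalgebra.closure G)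
            (⟨x, BooleanSubalgebra.subset_closure hx⟩ : BooleanSubalgebra.closure G)
        rw [this]
        exact inf_le_inf_right _ heg⟩ inf_le_left
      have hgx : g ≤ x := hle.trans inf_le_right
      exact heg.trans (OrderHomClass.mono h (show (⟨g, _⟩ : BooleanSubalgebra.closure G) ≤ ⟨x, _⟩
        from hgx))
    | bot => right; exact (congrArg (e ⊓ ·) (map_bot h)).trans (inf_bot_eq _)
    | sup x hx y hy ihx ihy =>
      have hs : h ⟨x ⊔ y, BooleanSubalgebra.sup_mem hx hy⟩ = h ⟨x, hx⟩ ⊔ h ⟨y, hy⟩ :=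
        map_sup h (⟨x, hx⟩ : BooleanSubalgebra.closure G)
          (⟨y, hy⟩ : BooleanSubalgebra.closure G)
      rw [hs]
      rcases ihx with ihx | ihx
      · exact .inl (ihx.trans le_sup_left)
      rcases ihy with ihy | ihy
      · exact .inl (ihy.trans le_sup_right)
      right
      rw [inf_sup_left, ihx, ihy, sup_bot_eq]
    | compl x hx ih =>
      have hs : h ⟨xᶜ, BooleanSubalgebra.compl_mem hx⟩ = (h ⟨x, hx⟩)ᶜ := map_compl' h ⟨x, hx⟩
      rw [hs]
      rcases ih with ih | ih
      · right
        rw [← disjoint_iff]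
        exact disjoint_compl_right.mono_left ih
      · left
        exact le_compl_iff_disjoint_right.2 (disjoint_iff.2 ih)
  refine ⟨e, ⟨he0, fun b hb => ?_⟩, hec⟩
  obtain ⟨⟨x, hx⟩, rfl⟩ := hsurj b
  rcases key x hx with hk | hk
  · exact absurd (hb.trans_le hk) (lt_irrefl _)
  · rwa [inf_eq_right.2 hb.le] at hk

theorem mk_booleanSubalgebra_closure_le {α : Type} [BooleanAlgebra α] (G : Set α) :
    #(BooleanSubalgebra.closure G) ≤ max #G ℵ₀ := by
  have hsub : ∀ x ∈ BooleanSubalgebra.closure G,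
      toBoolRing x ∈ Algebra.adjoin ℤ (toBoolRing '' G) := by
    intro x hx
    induction hx using BooleanSubalgebra.closure_bot_sup_induction with
    | mem x hx => exact Algebra.subset_adjoin ⟨x, hx, rfl⟩
    | bot => exact zero_mem _
    | sup x hx y hy ihx ihy =>
      have : toBoolRing (x ⊔ y) = toBoolRing x + toBoolRing y + toBoolRing x * toBoolRing y := by
        rw [← ofBoolRing_inj]
        simp [symmDiff_symmDiff_inf]
      rw [this]
      exact add_mem (add_mem ihx ihy) (mul_mem ihx ihy)
    | compl x hx ih =>
      have : toBoolRing xᶜ = 1 + toBoolRing x := by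
        rw [← ofBoolRing_inj]
        simp
      rw [this]
      exact add_mem (one_mem _) ih
  have h1 : #(BooleanSubalgebra.closure G) ≤ #(Algebra.adjoin ℤ (toBoolRing '' G)) :=
    Cardinal.mk_le_of_injective
      (f := fun x : BooleanSubalgebra.closure G =>
        (⟨toBoolRing x.1, hsub x.1 x.2⟩ : Algebra.adjoin ℤ (toBoolRing '' G)))
      fun x y hxy => Subtype.ext (toBoolRing_inj.1 (congrArg Subtype.val hxy :))
  refine h1.trans ((Algebra.cardinalMk_adjoin_le ℤ (toBoolRing '' G)).trans ?_)
  rw [Cardinal.mk_int]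
  exact max_le (max_le (le_max_right _ _) (Cardinal.mk_image_le.trans (le_max_left _ _)))
    (le_max_right _ _)

/-- The family of all finite sets, all members of `S`, and all infinite traces on members of `S`
of the sets `A i`. -/
def generatingFamily {X ι : Type*} (S : Set (Set X)) (A : ι → Set X) : Set (Set X) :=
  {F | F.Finite} ∪ (S ∪ {Y | Y.Infinite ∧ ∃ i, ∃ g ∈ S, Y = A i ∩ g})

section GeneratingFamily

variable {X ι : Type*} {S : Set (Set X)} {A : ι → Set X}

theorem infClosed_generatingFamily (hS : InfClosed S)
    (hA : ∀ i j, i ≠ j → (A i ∩ A j).Finite) : InfClosed (generatingFamily S A) := by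
  intro a ha b hb
  by_cases hfin : (a ∩ b).Finite
  · exact .inl hfin
  rcases ha with ha | ha | ⟨-, i, g, hg, rfl⟩
  · exact absurd (ha.inter_of_left b) hfin
  · rcases hb with hb | hb | ⟨-, j, g', hg', rfl⟩
    · exact absurd (hb.inter_of_right a) hfin
    · exact .inr (.inl (hS ha hb))
    · exact .inr (.inr ⟨hfin, j, a ∩ g', hS ha hg', Set.inter_left_comm _ _ _⟩)
  · rcases hb with hb | hb | ⟨-, j, g', hg', rfl⟩
    · exact absurd (hb.inter_of_right _) hfin
    · exact .inr (.inr ⟨hfin, i, g ∩ b, hS hg hb, Set.inter_assoc _ _ _⟩)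
    · have hij : i = j := by
        by_contra hij
        exact hfin ((hA i j hij).subset fun x hx => ⟨hx.1.1, hx.2.1⟩)
      subst hij
      exact .inr (.inr ⟨hfin, i, g ∩ g', hS hg hg', (Set.inter_inter_distrib_left _ _ _).symm⟩)

theorem isWF_generatingFamily (hS : InfClosed S) (hwf : S.IsWF)
    (hA : ∀ i j, i ≠ j → (A i ∩ A j).Finite) : (generatingFamily S A).IsWF := by
  refine Set.IsWF.union (Set.isWF_iff_exists_minimal.2 fun t ht hne => ?_)
    (Set.IsWF.union hwf (Set.isWF_iff_exists_minimal.2 fun t ht hne => ?_))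
  · obtain ⟨m, hm, hmin⟩ := WellFounded.has_min
      (InvImage.wf (Set.ncard : Set X → ℕ) wellFounded_lt) t hne
    refine ⟨m, hm, fun y hy hle => ?_⟩
    by_contra hn
    exact hmin y hy (Set.ncard_lt_ncard (lt_of_le_not_ge hle hn) (ht hm))
  · obtain ⟨y, hy⟩ := hne
    obtain ⟨-, i₀, g₀, hg₀, rfl⟩ := ht hy
    obtain ⟨g, ⟨hg, i, hgi⟩, hmin⟩ := Set.isWF_iff_exists_minimal.1 hwf
      {g | g ∈ S ∧ ∃ i, A i ∩ g ∈ t} (fun g hg => hg.1) ⟨g₀, hg₀, i₀, hy⟩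
    refine ⟨A i ∩ g, hgi, fun z hz hle => ?_⟩
    obtain ⟨hinf, j, g', hg', rfl⟩ := ht hz
    have hij : i = j := by
      by_contra hij
      exact hinf ((hA i j hij).subset fun x hx => ⟨(hle hx).1, hx.1⟩)
    subst hij
    have heq : A i ∩ (g ∩ g') = A i ∩ g' :=
      Set.Subset.antisymm (fun x hx => ⟨hx.1, hx.2.2⟩) fun x hx => ⟨hx.1, (hle hx).2, hx.2⟩
    have := hmin (y := g ∩ g') ⟨hS hg hg', i, heq ▸ hz⟩ Set.inter_subset_left
    exact fun x hx => ⟨hx.1, (this hx.2).2⟩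

theorem finite_mem_closure_generatingFamily {F : Set X} (hF : F.Finite) :
    F ∈ BooleanSubalgebra.closure (generatingFamily S A) :=
  BooleanSubalgebra.subset_closure (.inl hF)

theorem mem_closure_generatingFamily (htop : Set.univ ∈ S) (i : ι) :
    A i ∈ BooleanSubalgebra.closure (generatingFamily S A) := by
  by_cases h : (A i).Finite
  · exact finite_mem_closure_generatingFamily h
  · exact BooleanSubalgebra.subset_closure
      (.inr (.inr ⟨h, i, Set.univ, htop, (Set.inter_univ _).symm⟩))

/-- If every countable member of a Boolean algebra `D ⊇ S` is empty, then the countable members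
of the algebra generated by `generatingFamily S A` are almost covered by finitely many `A i`. -/
theorem exists_finite_diff_of_countable {D : BooleanSubalgebra (Set X)} (hSD : S ⊆ D)
    (hD : ∀ Y ∈ D, Y.Countable → Y = ∅) (hA : ∀ i, (A i).Countable) {Y : Set X}
    (hY : Y ∈ BooleanSubalgebra.closure (generatingFamily S A)) (hYc : Y.Countable) :
    ∃ s : Set ι, s.Finite ∧ (Y \ ⋃ i ∈ s, A i).Finite := by
  have key : ∃ Z ∈ D, ∃ s : Set ι, s.Finite ∧ (symmDiff Y Z \ ⋃ i ∈ s, A i).Finite := by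
    clear hYc
    induction hY using BooleanSubalgebra.closure_bot_sup_induction with
    | mem Y hY =>
      rcases hY with hY | hY | ⟨-, i, g, hg, rfl⟩
      · refine ⟨⊥, D.bot_mem, ∅, Set.finite_empty, ?_⟩
        simpa using hY
      · exact ⟨Y, hSD hY, ∅, Set.finite_empty, by simp⟩
      · refine ⟨⊥, D.bot_mem, {i}, Set.finite_singleton i, ?_⟩
        rw [symmDiff_bot]
        convert Set.finite_empty
        ext x
        simp +contextual
    | bot => exact ⟨⊥, D.bot_mem, ∅, Set.finite_empty, by simp⟩
    | sup Y₁ _ Y₂ _ ih₁ ih₂ =>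
      obtain ⟨Z₁, hZ₁, s₁, hs₁, h₁⟩ := ih₁
      obtain ⟨Z₂, hZ₂, s₂, hs₂, h₂⟩ := ih₂
      refine ⟨Z₁ ⊔ Z₂, D.sup_mem hZ₁ hZ₂, s₁ ∪ s₂, hs₁.union hs₂, (h₁.union h₂).subset ?_⟩
      rintro x ⟨hx, hxs⟩
      simp only [Set.mem_symmDiff, Set.sup_eq_union, Set.mem_union, Set.mem_sdiff, Set.mem_iUnion]
        at hx hxs ⊢
      grind
    | compl Y _ ih =>
      obtain ⟨Z, hZ, s, hs, h⟩ := ih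
      exact ⟨Zᶜ, D.compl_mem hZ, s, hs, by rwa [compl_symmDiff_compl]⟩
  obtain ⟨Z, hZ, s, hs, h⟩ := key
  have hZ0 : Z = ∅ := by
    refine hD Z hZ ((hYc.union (h.countable.union (hs.countable.biUnion fun i _ => hA i))).mono ?_)
    intro x hx
    simp only [Set.mem_symmDiff, Set.mem_union, Set.mem_sdiff]
    tauto
  subst hZ0
  exact ⟨s, hs, symmDiff_bot Y ▸ h⟩

end GeneratingFamily

section Automorphisms

variable {X : Type} {L : BooleanSubalgebra (Set X)}

theorem isAtom_iff_exists_eq_singleton (hfin : ∀ F : Set X, F.Finite → F ∈ L) (a : L) :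
    IsAtom a ↔ ∃ x, (a : Set X) = {x} := by
  constructor
  · rintro ⟨hne, hmin⟩
    have hne' : (a : Set X).Nonempty := by
      rw [Set.nonempty_iff_ne_empty]
      exact fun h => hne (Subtype.ext h)
    obtain ⟨x, hx⟩ := hne'
    refine ⟨x, ?_⟩
    by_contra hax
    have hlt : (⟨{x}, hfin _ (Set.finite_singleton x)⟩ : L) < a :=
      lt_of_le_of_ne (Set.singleton_subset_iff.2 hx) fun h => hax (congrArg Subtype.val h).symm
    exact Set.singleton_ne_empty x (congrArg Subtype.val (hmin _ hlt))
  · rintro ⟨x, hx⟩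
    refine ⟨fun h => ?_, fun b hb => ?_⟩
    · rw [h] at hx
      exact Set.singleton_ne_empty x hx.symm
    · have hb' : (b : Set X) ⊂ {x} := hx ▸ hb
      exact Subtype.ext (Set.ssubset_singleton_iff.1 hb')

theorem mk_atoms_eq (hfin : ∀ F : Set X, F.Finite → F ∈ L) : #{a : L // IsAtom a} = #X := by
  refine Cardinal.mk_congr (Equiv.ofBijective
    (fun x : X => (⟨⟨{x}, hfin _ (Set.finite_singleton x)⟩,
      (isAtom_iff_exists_eq_singleton hfin _).2 ⟨x, rfl⟩⟩ : {a : L // IsAtom a})) ⟨?_, ?_⟩).symm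
  · intro x y hxy
    exact Set.singleton_injective (congrArg (fun a => (a.1 : Set X)) hxy :)
  · rintro ⟨a, ha⟩
    obtain ⟨x, hx⟩ := (isAtom_iff_exists_eq_singleton hfin a).1 ha
    exact ⟨x, Subtype.ext (Subtype.ext hx.symm)⟩

theorem exists_perm_of_orderIso (hfin : ∀ F : Set X, F.Finite → F ∈ L) (φ : L ≃o L) :
    ∃ π : Equiv.Perm X, ∀ Y : L, (φ Y : Set X) = π '' Y := by
  let sing : X → L := fun x => ⟨{x}, hfin _ (Set.finite_singleton x)⟩
  have hsing : ∀ x (Y : L), sing x ≤ Y ↔ x ∈ (Y : Set X) := fun x Y => Set.singleton_subset_iff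
  have hat : ∀ (ψ : L ≃o L) x, ∃ y, ψ (sing x) = sing y := by
    intro ψ x
    obtain ⟨y, hy⟩ := (isAtom_iff_exists_eq_singleton hfin (ψ (sing x))).1
      ((OrderIso.isAtom_iff ψ _).2 ((isAtom_iff_exists_eq_singleton hfin _).2 ⟨x, rfl⟩))
    exact ⟨y, Subtype.ext hy⟩
  have hinj : Function.Injective sing := fun x y h =>
    Set.singleton_injective (congrArg Subtype.val h :)
  choose f hf using hat φ
  choose g hg using hat φ.symm
  let π : Equiv.Perm X :=
    { toFun := f
      invFun := g
      left_inv := fun x => hinj (by rw [← hg, ← hf, φ.symm_apply_apply])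
      right_inv := fun x => hinj (by rw [← hf, ← hg, φ.apply_symm_apply]) }
  refine ⟨π, fun Y => ?_⟩
  ext x
  rw [Equiv.image_eq_preimage_symm, Set.mem_preimage, ← hsing, ← hsing]
  change _ ↔ sing (g x) ≤ Y
  rw [← hg, φ.symm_apply_le]

theorem mk_le_mk_orderIso (hfin : ∀ F : Set X, F.Finite → F ∈ L) : #X ≤ #(L ≃o L) := by
  classical
  rcases isEmpty_or_nonempty X with h | ⟨⟨x₀⟩⟩
  · simp
  have hmem : ∀ x (Y : L), Equiv.swap x₀ x '' (Y : Set X) ∈ L := by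
    intro x Y
    have hF : (symmDiff (Y : Set X) (Equiv.swap x₀ x '' (Y : Set X))).Finite := by
      refine (Set.toFinite {x₀, x}).subset fun y hy => ?_
      by_contra hn
      have hy' : Equiv.swap x₀ x y = y :=
        Equiv.swap_apply_of_ne_of_ne (fun h => hn (by simp [h])) (fun h => hn (by simp [h]))
      rw [Set.mem_symmDiff, Equiv.image_eq_preimage_symm, Set.mem_preimage, Equiv.symm_swap,
        hy'] at hy
      tauto
    have := symmDiff_symmDiff_cancel_left (Y : Set X) (Equiv.swap x₀ x '' (Y : Set X))
    rw [← this]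
    rw [symmDiff_def (Y : Set X)]
    exact L.sup_mem (L.sdiff_mem Y.2 (hfin _ hF)) (L.sdiff_mem (hfin _ hF) Y.2)
  let σ : X → (L ≃o L) := fun x =>
    { toFun := fun Y => ⟨Equiv.swap x₀ x '' (Y : Set X), hmem x Y⟩
      invFun := fun Y => ⟨Equiv.swap x₀ x '' (Y : Set X), hmem x Y⟩
      left_inv := fun Y => Subtype.ext (by simp [Set.image_image])
      right_inv := fun Y => Subtype.ext (by simp [Set.image_image])
      map_rel_iff' := fun {Y Z} => Set.image_subset_image_iff (Equiv.injective _) }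
  refine Cardinal.mk_le_of_injective (f := σ) fun x y hxy => ?_
  have h := congrArg (fun φ : L ≃o L => (φ ⟨{x₀}, hfin _ (Set.finite_singleton x₀)⟩ : Set X)) hxy
  simpa [σ] using h

theorem mk_orderIso_le [Nonempty X] {M : Type} (hfin : ∀ F : Set X, F.Finite → F ∈ L)
    (hsupp : ∀ (φ : L ≃o L) (π : Equiv.Perm X), (∀ Y : L, (φ Y : Set X) = π '' Y) →
      #{x | π x ≠ x} < #M) : #(L ≃o L) ≤ #((M → X) × (M → X)) := by
  classical
  choose π hπ using exists_perm_of_orderIso hfin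
  have hcover : ∀ φ : L ≃o L, ∃ u : M → X, ∀ x, π φ x ≠ x → ∃ m, u m = x := by
    intro φ
    have hlt := hsupp φ (π φ) (hπ φ)
    by_cases hne : {x | π φ x ≠ x}.Nonempty
    · obtain ⟨e⟩ := (Cardinal.le_def _ _).1 hlt.le
      have := hne.to_subtype
      refine ⟨fun m => (Function.invFun e m : {x | π φ x ≠ x}).1, fun x hx => ⟨e ⟨x, hx⟩, ?_⟩⟩
      exact congrArg Subtype.val (Function.leftInverse_invFun e.injective ⟨x, hx⟩)
    · exact ⟨fun _ => Classical.arbitrary X, fun x hx => absurd ⟨x, hx⟩ hne⟩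
  choose u hu using hcover
  refine Cardinal.mk_le_of_injective (f := fun φ => (u φ, fun m => π φ (u φ m)))
    fun φ ψ h => ?_
  obtain ⟨h1, h2⟩ := Prod.ext_iff.1 h
  simp only at h1 h2
  have hfix : ∀ x, π φ x = π ψ x := by
    intro x
    by_cases hx : ∃ m, u φ m = x
    · obtain ⟨m, rfl⟩ := hx
      have := congrFun h2 m
      rwa [← h1] at this
    · have h3 : π φ x = x := by
        by_contra h3
        exact hx (hu φ x h3)
      have h4 : π ψ x = x := by
        by_contra h4
        exact hx (h1 ▸ hu ψ x h4)
      rw [h3, h4]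
  refine OrderIso.ext (funext fun Y => Subtype.ext ?_)
  rw [hπ, hπ, show π φ = π ψ from Equiv.ext hfix]

/-- A permutation with large support maps some large set to a set disjoint from it. -/
theorem exists_disjoint_image_of_le_mk_support {M : Type} [Infinite M] (π : Equiv.Perm X)
    (h : #M ≤ #{x | π x ≠ x}) : ∃ d : M → X, Function.Injective d ∧
      ∀ m m', π (d m) ≠ d m' := by
  obtain ⟨D, hD⟩ := zorn_subset {D : Set X | ∀ x ∈ D, ∀ y ∈ D, π x ≠ y} (by
    intro c hc hchain
    refine ⟨⋃₀ c, ?_, fun s hs => Set.subset_sUnion_of_mem hs⟩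
    rintro x ⟨s, hs, hxs⟩ y ⟨t, ht, hyt⟩
    rcases hchain.total hs ht with hst | hst
    · exact hc ht x (hst hxs) y hyt
    · exact hc hs x hxs y (hst hyt))
  have hcov : {x | π x ≠ x} ⊆ D ∪ (π '' D ∪ π.symm '' D) := by
    intro x hx
    by_contra hn
    simp only [Set.mem_union, not_or] at hn
    obtain ⟨h1, h2, h3⟩ := hn
    refine h1 (hD.2 (y := insert x D) ?_ (Set.subset_insert x D) (Set.mem_insert x D))
    rintro y (rfl | hy) z (rfl | hz) hyz
    · exact hx hyz
    · exact h3 ⟨z, hz, by rw [← hyz, π.symm_apply_apply]⟩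
    · exact h2 ⟨y, hy, hyz⟩
    · exact hD.1 y hy z hz hyz
  have hle : #M ≤ #D := by
    by_contra! hlt
    have h1 : #(π '' D : Set X) < #M := Cardinal.mk_image_le.trans_lt hlt
    have h2 : #(π.symm '' D : Set X) < #M := Cardinal.mk_image_le.trans_lt hlt
    have hM := Cardinal.aleph0_le_mk M
    refine (h.trans ((Cardinal.mk_le_mk_of_subset hcov).trans (Cardinal.mk_union_le _ _))).not_gt ?_
    exact Cardinal.add_lt_of_lt hM hlt
      ((Cardinal.mk_union_le _ _).trans_lt (Cardinal.add_lt_of_lt hM h1 h2))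
  obtain ⟨e⟩ := (Cardinal.le_def _ _).1 hle
  exact ⟨fun m => e m, fun m m' hm => e.injective (Subtype.ext hm),
    fun m m' => hD.1 _ (e m).2 _ (e m').2⟩

end Automorphisms

/-- If fewer than `#M ^ ℵ₀` countable sets are given, some infinite countable set is almost
disjoint from all of them. -/
theorem exists_infinite_countable_almost_disjoint {M : Type} [Infinite M] {𝒞 : Set (Set M)}
    (hc : ∀ C ∈ 𝒞, C.Countable) (hcont : (2 : Cardinal) ^ ℵ₀ < #M ^ ℵ₀) (hcard : #𝒞 < #M ^ ℵ₀) :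
    ∃ N : Set M, N.Infinite ∧ N.Countable ∧ ∀ C ∈ 𝒞, (N ∩ C).Finite := by
  obtain ⟨e⟩ : Nonempty (List M ≃ M) := Cardinal.eq.1 (Cardinal.mk_list_eq_mk M)
  let c : (ℕ → M) → ℕ → M := fun η n => e (List.ofFn fun i : Fin n => η i)
  have hlen : ∀ {η η' n n'}, c η n = c η' n' → n = n' := by
    intro η η' n n' h
    simpa using congrArg List.length (e.injective h)
  have hcinj : ∀ η, Function.Injective (c η) := fun η n n' h => hlen h
  have hagree : ∀ {η η' n}, c η n = c η' n → ∀ i < n, η i = η' i := by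
    intro η η' n h i hi
    exact congrFun (List.ofFn_injective (e.injective h)) ⟨i, hi⟩
  by_contra! hcon
  have hbad : ∀ η : ℕ → M, ∃ C : 𝒞, (Set.range (c η) ∩ C).Infinite := by
    intro η
    obtain ⟨C, hC, hinf⟩ := hcon (Set.range (c η)) (Set.infinite_range_of_injective (hcinj η))
      (Set.countable_range _)
    exact ⟨⟨C, hC⟩, hinf⟩
  choose C hC using hbad
  have hcode : ∀ D : 𝒞, ∃ f : Set M → Set ℕ, Set.InjOn f {s | s ⊆ D} := by
    intro D
    obtain ⟨g, hg⟩ := Set.countable_iff_exists_injOn.1 (hc D D.2)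
    refine ⟨fun s => g '' s, fun s hs t ht hst => ?_⟩
    exact (hg.image_eq_image_iff hs ht).1 hst
  choose code hcode' using hcode
  have hle : #(ℕ → M) ≤ #(𝒞 × Set ℕ) := by
    refine Cardinal.mk_le_of_injective
      (f := fun η => (C η, code (C η) (Set.range (c η) ∩ C η))) fun η η' h => ?_
    obtain ⟨h1, h2⟩ := Prod.ext_iff.1 h
    simp only at h1 h2
    rw [← h1] at h2
    have h3 : Set.range (c η) ∩ C η = Set.range (c η') ∩ C η :=
      hcode' (C η) Set.inter_subset_right Set.inter_subset_right h2
    funext i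
    have hI : {n | c η n ∈ (C η : Set M)}.Infinite := by
      intro hfin
      refine hC η ((hfin.image (c η)).subset ?_)
      rintro _ ⟨⟨n, rfl⟩, hn⟩
      exact ⟨n, hn, rfl⟩
    obtain ⟨n, hn, hin⟩ := hI.exists_gt i
    obtain ⟨⟨n', hn'⟩, -⟩ : c η n ∈ Set.range (c η') ∩ C η := h3 ▸ ⟨⟨n, rfl⟩, hn⟩
    obtain rfl := hlen hn'
    exact (hagree hn' i hin).symm
  refine hle.not_gt ?_
  have hinf : ℵ₀ ≤ #M ^ ℵ₀ := (Cardinal.cantor _).le.trans hcont.le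
  simpa using Cardinal.mul_lt_of_lt hinf hcard hcont

/-- A diagonalisation: there are countable sets `d '' N`, one for each pair `(d, e)` of injections
with disjoint ranges, which are pairwise almost disjoint and such that `e '' N` is almost disjoint
from all of them. -/
theorem exists_diagonal_family {M X : Type} [Infinite M]
    (hcont : (2 : Cardinal) ^ ℵ₀ < #M ^ ℵ₀)
    (hcard : #((M → X) × (M → X)) ≤ #M ^ ℵ₀) :
    ∃ (ι : Type) (A : ι → Set X), #ι ≤ #M ^ ℵ₀ ∧ (∀ i, (A i).Countable) ∧
      (∀ i j, i ≠ j → (A i ∩ A j).Finite) ∧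
      ∀ d e : M → X, Function.Injective d → Function.Injective e → (∀ m m', e m ≠ d m') →
        ∃ i, ∃ N : Set M, N.Infinite ∧ A i = d '' N ∧ ∀ j, (e '' N ∩ A j).Finite := by
  let ι := {p : (M → X) × (M → X) // Function.Injective p.1 ∧ Function.Injective p.2 ∧
    ∀ m m', p.2 m ≠ p.1 m'}
  have hι : #ι ≤ #M ^ ℵ₀ := (Cardinal.mk_subtype_le _).trans hcard
  obtain ⟨r, hr, hord⟩ := Cardinal.exists_ord_eq ι
  let 𝒩 := {N : Set M // N.Infinite ∧ N.Countable}
  let 𝒞 : (i : ι) → ((j : ι) → r j i → 𝒩) → Set (Set M) := fun i prev =>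
    (Set.range fun j : {j // r j i} => i.1.1 ⁻¹' (j.1.1.1 '' (prev j.1 j.2).1)) ∪
    ((Set.range fun j : {j // r j i} => i.1.2 ⁻¹' (j.1.1.1 '' (prev j.1 j.2).1)) ∪
    (Set.range fun j : {j // r j i} => i.1.1 ⁻¹' (j.1.1.2 '' (prev j.1 j.2).1)))
  have hstep : ∀ (i : ι) (prev : (j : ι) → r j i → 𝒩), ∃ N : 𝒩, ∀ C ∈ 𝒞 i prev,
      (N.1 ∩ C).Finite := by
    intro i prev
    have hpred : #{j // r j i} < #M ^ ℵ₀ :=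
      (Ordinal.card_typein (r := r) i ▸ Cardinal.card_typein_lt i hord).trans_le hι
    have hinf : ℵ₀ ≤ #M ^ ℵ₀ := (Cardinal.cantor _).le.trans hcont.le
    obtain ⟨N, hN, hNc, hNC⟩ := exists_infinite_countable_almost_disjoint (𝒞 := 𝒞 i prev) (by
        rintro C (⟨j, rfl⟩ | ⟨j, rfl⟩ | ⟨j, rfl⟩)
        · exact ((prev j.1 j.2).2.2.image _).preimage i.2.1
        · exact ((prev j.1 j.2).2.2.image _).preimage i.2.2.1
        · exact ((prev j.1 j.2).2.2.image _).preimage i.2.1) hcont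
      ((Cardinal.mk_union_le _ _).trans_lt (Cardinal.add_lt_of_lt hinf
        (Cardinal.mk_range_le.trans_lt hpred)
        ((Cardinal.mk_union_le _ _).trans_lt (Cardinal.add_lt_of_lt hinf
          (Cardinal.mk_range_le.trans_lt hpred) (Cardinal.mk_range_le.trans_lt hpred)))))
    exact ⟨⟨N, hN, hNc⟩, hNC⟩
  choose step hstep' using hstep
  let N : ι → 𝒩 := hr.wf.fix step
  have hN : ∀ i, ∀ C ∈ 𝒞 i (fun j _ => N j), ((N i).1 ∩ C).Finite := by
    intro i
    have : N i = step i (fun j _ => N j) := hr.wf.fix_eq step i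
    rw [this]
    exact hstep' i fun j _ => N j
  have himg : ∀ (f : M → X) (s : Set M) (t : Set X), (s ∩ f ⁻¹' t).Finite →
      (f '' s ∩ t).Finite := fun f s t h => Set.image_inter_preimage f s t ▸ h.image f
  have h1 : ∀ i j, r j i → (i.1.1 '' (N i).1 ∩ j.1.1 '' (N j).1).Finite := fun i j hji =>
    himg _ _ _ (hN i _ (.inl ⟨⟨j, hji⟩, rfl⟩))
  have h2 : ∀ i j, r j i → (i.1.2 '' (N i).1 ∩ j.1.1 '' (N j).1).Finite := fun i j hji =>
    himg _ _ _ (hN i _ (.inr (.inl ⟨⟨j, hji⟩, rfl⟩)))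
  have h3 : ∀ i j, r j i → (i.1.1 '' (N i).1 ∩ j.1.2 '' (N j).1).Finite := fun i j hji =>
    himg _ _ _ (hN i _ (.inr (.inr ⟨⟨j, hji⟩, rfl⟩)))
  refine ⟨ι, fun i => i.1.1 '' (N i).1, hι, fun i => (N i).2.2.image _, fun i j hij => ?_,
    fun d e hd he hde => ⟨⟨(d, e), hd, he, hde⟩, (N ⟨(d, e), hd, he, hde⟩).1,
      (N ⟨(d, e), hd, he, hde⟩).2.1, rfl, fun j => ?_⟩⟩
  · rcases trichotomous_of r i j with h | h | h
    · rw [Set.inter_comm]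
      exact h1 j i h
    · exact absurd h hij
    · exact h1 i j h
  · rcases trichotomous_of r ⟨(d, e), hd, he, hde⟩ j with h | h | h
    · rw [Set.inter_comm]
      exact h3 j _ h
    · subst h
      convert Set.finite_empty
      ext x
      simp only [Set.mem_inter_iff, Set.mem_image, Set.mem_empty_iff_false, iff_false]
      rintro ⟨⟨m, -, rfl⟩, m', -, h⟩
      exact hde m m' h.symm
    · exact h2 _ j h

/-- For a strong limit cardinal of countable cofinality, `μ ^ ℵ₀ = 2 ^ μ`. -/
theorem Cardinal.IsStrongLimit.power_aleph0_eq {μ : Cardinal.{0}} (hsl : μ.IsStrongLimit)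
    (hcf : μ.ord.cof = ℵ₀) : μ ^ ℵ₀ = 2 ^ μ := by
  have hμ : ℵ₀ ≤ μ := hsl.aleph0_le
  apply le_antisymm
  · calc μ ^ ℵ₀ ≤ μ ^ μ := Cardinal.power_le_power_left hsl.ne_zero hμ
      _ = 2 ^ μ := Cardinal.power_self_eq hμ
  let M := μ.ord.ToType
  have hM : #M = μ := by simp [M]
  obtain ⟨S, hS, hScard⟩ := Order.exists_cof_eq (α := M)
  have hScard' : #S = ℵ₀ := by rw [hScard, ← hcf, Ordinal.cof_toType]
  have hcode : ∀ s : S, ∃ f : Set (Set.Iic s.1) → M, Function.Injective f := by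
    intro s
    have hlt : #(Set.Iic s.1) < μ := by
      have h1 : #(Set.Iio s.1) < μ := by
        have := Cardinal.mk_Iio_lt s.1 (by simp [M])
        rwa [hM] at this
      rw [← Set.Iio_insert]
      exact (Cardinal.mk_insert_le).trans_lt
        (Cardinal.add_lt_of_lt hμ h1 (Cardinal.one_lt_aleph0.trans_le hμ))
    have h2 : #(Set (Set.Iic s.1)) ≤ #M := by
      rw [Cardinal.mk_set, hM]
      exact (hsl.isStrongPrelimit hlt).le
    obtain ⟨f⟩ := (Cardinal.le_def _ _).1 h2
    exact ⟨f, f.injective⟩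
  choose f hf using hcode
  have hle : #(Set M) ≤ #(S → M) := by
    refine Cardinal.mk_le_of_injective (f := fun Y s => f s (Subtype.val ⁻¹' Y)) fun Y Z h => ?_
    ext m
    obtain ⟨s, hs, hms⟩ := hS m
    have := hf ⟨s, hs⟩ (congrFun h ⟨s, hs⟩)
    exact Set.ext_iff.1 this ⟨m, hms⟩
  simpa [hM, hScard'] using hle

section Tree

variable {T : Type} [PartialOrder T]

/-- A downward closed set which is well-ordered by `<`. -/
def IsInitialChain (b : Set T) : Prop :=
  (∀ s t : T, s < t → t ∈ b → s ∈ b) ∧ IsWellOrder b (· < ·)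

theorem IsInitialChain.eq_inter_or_exists {b : Set T} (hb : IsInitialChain b) {c : Set T}
    (hc : ∀ s t : T, s < t → t ∈ c → s ∈ c) : b ∩ c = b ∨ ∃ t ∈ b, b ∩ c = Set.Iio t := by
  refine or_iff_not_imp_left.2 fun hne => ?_
  have hwo := hb.2
  have hex : {t : b | t.1 ∉ c}.Nonempty := by
    by_contra hemp
    refine hne (Set.inter_eq_left.2 fun t ht => ?_)
    by_contra htc
    exact hemp ⟨⟨t, ht⟩, htc⟩
  obtain ⟨t, ht, hmin⟩ := hwo.wf.has_min _ hex
  refine ⟨t, t.2, Set.Subset.antisymm ?_ fun s hs => ?_⟩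
  · rintro s ⟨hsb, hsc⟩
    rcases trichotomous_of (α := b) (· < ·) ⟨s, hsb⟩ t with h | h | h
    · exact h
    · exact absurd (h ▸ hsc) ht
    · exact absurd (hc t s h hsc) ht
  · have hsb := hb.1 s t hs t.2
    refine ⟨hsb, ?_⟩
    by_contra hsc
    exact hmin ⟨s, hsb⟩ hsc hs

theorem isWF_of_isInitialChain {S : Set (Set T)} (hS : ∀ b ∈ S, IsInitialChain b) : S.IsWF := by
  refine Set.isWF_iff_exists_minimal.2 fun H hH ⟨b, hb⟩ => ?_
  by_cases hbm : Minimal (· ∈ H) b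
  · exact ⟨b, hbm⟩
  have hproper : ∀ c ∈ H, c ⊆ b → ¬ b ⊆ c → ∃ t ∈ b, c = Set.Iio t := by
    intro c hc hcb hbc
    rcases (hS b (hH hb)).eq_inter_or_exists (hS c (hH hc)).1 with h | h
    · exact absurd (Set.inter_eq_left.1 h) hbc
    · rwa [Set.inter_eq_right.2 hcb] at h
  have hex : {t : b | Set.Iio t.1 ∈ H}.Nonempty := by
    by_contra hemp
    refine hbm ⟨hb, fun c hc hcb => ?_⟩
    by_contra hbc
    obtain ⟨t, ht, rfl⟩ := hproper c hc hcb hbc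
    exact hemp ⟨⟨t, ht⟩, hc⟩
  obtain ⟨t, ht, hmin⟩ := (hS b (hH hb)).2.wf.has_min _ hex
  refine ⟨Set.Iio t.1, ht, fun c hc hct => ?_⟩
  have htb : Set.Iio t.1 ⊆ b := fun s hs => (hS b (hH hb)).1 s t hs t.2
  by_contra htc
  obtain ⟨s, hs, rfl⟩ := hproper c hc (Set.Subset.trans hct htb) fun hbc =>
    lt_irrefl _ (hct (hbc t.2))
  refine hmin ⟨s, hs⟩ hc ?_
  have hwo := (hS b (hH hb)).2
  rcases trichotomous_of (α := b) (· < ·) ⟨s, hs⟩ t with h | h | h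
  · exact h
  · exact absurd (h ▸ le_rfl) htc
  · exact absurd (show t.1 ∈ Set.Iio t.1 from hct h) (lt_irrefl t.1)

theorem exists_wellFounded_infClosed_family {κ χ : Cardinal} (hT : IsTreeWithLevels T κ)
    (hχ : χ = #{b : Set T // IsKappaBranch T κ b}) (hTχ : #T ≤ χ) (hχinf : ℵ₀ ≤ χ) :
    ∃ S : Set (Set T), InfClosed S ∧ Set.univ ∈ S ∧ S.IsWF ∧ #S = χ := by
  let S₀ : Set (Set T) := Set.range Set.Iio ∪ {b | IsKappaBranch T κ b}
  have hS₀ : ∀ b ∈ S₀, IsInitialChain b := by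
    rintro b (⟨t, rfl⟩ | hb)
    · exact ⟨fun s u hsu hut => hsu.trans hut, (hT.2 t).choose⟩
    · exact ⟨hb.2.1, hb.2.2.choose⟩
  have hinf : InfClosed S₀ := by
    intro b hb c hc
    rcases (hS₀ b hb).eq_inter_or_exists (hS₀ c hc).1 with h | ⟨t, -, h⟩
    · rwa [show b ⊓ c = b from h]
    · exact .inl ⟨t, h.symm⟩
  refine ⟨insert Set.univ S₀, ?_, Set.mem_insert _ _, ?_, ?_⟩
  · rintro b (rfl | hb) c (rfl | hc)
    · exact .inl (Set.inter_self _)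
    · exact .inr (by rwa [show Set.univ ⊓ c = c from Set.univ_inter c])
    · exact .inr (by rwa [show b ⊓ Set.univ = b from Set.inter_univ b])
    · exact .inr (hinf hb hc)
  · exact Set.IsWF.union (Set.finite_singleton _).isWF (isWF_of_isInitialChain hS₀)
  · apply le_antisymm
    · refine Cardinal.mk_insert_le.trans (Cardinal.add_le_of_le hχinf
        ((Cardinal.mk_union_le _ _).trans (Cardinal.add_le_of_le hχinf
          (Cardinal.mk_range_le.trans hTχ) hχ.ge)) (Cardinal.one_le_aleph0.trans hχinf))
    · rw [hχ]
      exact Cardinal.mk_le_mk_of_subset fun b hb => .inr (.inr hb)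

end Tree

theorem mk_generatingFamily_le {X ι : Type} {S : Set (Set X)} {A : ι → Set X} {χ : Cardinal}
    (hχ : ℵ₀ ≤ χ) (hX : #X ≤ χ) (hS : #S ≤ χ) (hι : #ι ≤ χ) : #(generatingFamily S A) ≤ χ := by
  refine (Cardinal.mk_union_le _ _).trans (Cardinal.add_le_of_le hχ ?_
    ((Cardinal.mk_union_le _ _).trans (Cardinal.add_le_of_le hχ hS ?_)))
  · have h : {F : Set X | F.Finite} ⊆ Set.range ((↑) : Finset X → Set X) := fun F hF =>
      ⟨hF.toFinset, hF.coe_toFinset⟩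
    refine (Cardinal.mk_le_mk_of_subset h).trans (Cardinal.mk_range_le.trans ?_)
    rcases finite_or_infinite X with hf | hf
    · exact (Cardinal.lt_aleph0_of_finite _).le.trans hχ
    · rwa [Cardinal.mk_finset_of_infinite]
  · have h : {Y : Set X | Y.Infinite ∧ ∃ i, ∃ g ∈ S, Y = A i ∩ g} ⊆
        Set.range fun p : ι × S => A p.1 ∩ p.2 := by
      rintro _ ⟨-, i, g, hg, rfl⟩
      exact ⟨(i, ⟨g, hg⟩), rfl⟩
    refine (Cardinal.mk_le_mk_of_subset h).trans (Cardinal.mk_range_le.trans ?_)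
    rw [Cardinal.mk_prod, Cardinal.lift_id, Cardinal.lift_id]
    exact (mul_le_mul' hι hS).trans (Cardinal.mul_eq_self hχ).le

theorem exists_superatomic_of_family {μ χ : Cardinal.{0}} (hsl : μ.IsStrongLimit) (hsing : ℵ₀ < μ)
    (hcf : μ.ord.cof = ℵ₀) {T : Type} [Infinite T] (hT : #T ≤ 2 ^ μ) (hχ : 2 ^ μ ≤ χ)
    {S : Set (Set T)} (hinf : InfClosed S) (huniv : Set.univ ∈ S) (hwf : S.IsWF) (hS : #S = χ) :
    ∃ (B : Type) (_ : BooleanAlgebra B), Superatomic B ∧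
      #B = χ ∧ #{a : B // IsAtom a} = #T + μ ∧
      #T + μ ≤ #(B ≃o B) ∧ #(B ≃o B) ≤ 2 ^ μ := by
  obtain ⟨M, rfl⟩ : ∃ M : Type, #M = μ := ⟨μ.out, μ.mk_out⟩
  have hMinf : Infinite M := Cardinal.infinite_iff.2 hsing.le
  have hpow : #M ^ ℵ₀ = 2 ^ #M := hsl.power_aleph0_eq hcf
  have hlam : ℵ₀ ≤ (2 : Cardinal) ^ #M := hsing.le.trans (Cardinal.cantor _).le
  have hX : #(T × M) = #T + #M := by
    rw [Cardinal.mk_prod, Cardinal.lift_id, Cardinal.lift_id,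
      Cardinal.mul_eq_max (Cardinal.aleph0_le_mk T) hsing.le,
      Cardinal.add_eq_max (Cardinal.aleph0_le_mk T)]
  have hXle : #(T × M) ≤ 2 ^ #M := by
    rw [hX]
    exact Cardinal.add_le_of_le hlam hT (Cardinal.cantor _).le
  have hpairs : #((M → T × M) × (M → T × M)) ≤ 2 ^ #M := by
    have h : #(M → T × M) ≤ 2 ^ #M := by
      rw [← Cardinal.power_def]
      refine (Cardinal.power_le_power_right hXle).trans ?_
      rw [← Cardinal.power_mul, Cardinal.mul_eq_self hsing.le]
    rw [Cardinal.mk_prod, Cardinal.lift_id]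
    exact (mul_le_mul' h h).trans (Cardinal.mul_eq_self hlam).le
  obtain ⟨ι, A, hι, hAc, hAA, hdiag⟩ := exists_diagonal_family (M := M) (X := T × M)
    (by
      rw [hpow]
      exact (hsl.isStrongPrelimit hsing).trans (Cardinal.cantor _))
    (by rwa [hpow])
  rw [hpow] at hι
  let p : Set T → Set (T × M) := fun g => Prod.fst ⁻¹' g
  have hpmono : ∀ {g g'}, p g ⊆ p g' ↔ g ⊆ g' := fun {g g'} =>
    Set.preimage_subset_preimage_iff
      ((Prod.fst_surjective (α := T) (β := M)).range_eq ▸ Set.subset_univ g)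
  have hpinj : Function.Injective p := fun g g' h =>
    Set.Subset.antisymm (hpmono.1 h.subset) (hpmono.1 h.symm.subset)
  let D : BooleanSubalgebra (Set (T × M)) :=
    { carrier := Set.range p
      supClosed' := by
        rintro _ ⟨g, rfl⟩ _ ⟨g', rfl⟩
        exact ⟨g ∪ g', rfl⟩
      infClosed' := by
        rintro _ ⟨g, rfl⟩ _ ⟨g', rfl⟩
        exact ⟨g ∩ g', rfl⟩
      compl_mem' := by
        rintro _ ⟨g, rfl⟩
        exact ⟨gᶜ, rfl⟩
      bot_mem' := ⟨∅, rfl⟩ }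
  have hD : ∀ Y ∈ D, Y.Countable → Y = ∅ := by
    rintro _ ⟨g, rfl⟩ hc
    by_contra hne
    obtain ⟨⟨t, m⟩, ht⟩ := Set.nonempty_iff_ne_empty.2 hne
    have hM : (Set.univ : Set M).Countable :=
      (hc.preimage (Prod.mk_right_injective t)).mono fun m _ => ht
    exact hsing.not_ge (Cardinal.mk_le_aleph0_iff.2 (Set.countable_univ_iff.1 hM))
  have hS'inf : InfClosed (p '' S) := by
    rintro _ ⟨g, hg, rfl⟩ _ ⟨g', hg', rfl⟩
    exact ⟨g ∩ g', hinf hg hg', rfl⟩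
  have hS'wf : (p '' S).IsWF := by
    refine Set.isWF_iff_exists_minimal.2 fun H hH ⟨Y, hY⟩ => ?_
    obtain ⟨g₀, hg₀, rfl⟩ := hH hY
    obtain ⟨g, ⟨hg, hgH⟩, hmin⟩ := Set.isWF_iff_exists_minimal.1 hwf {g | g ∈ S ∧ p g ∈ H}
      (fun g hg => hg.1) ⟨g₀, hg₀, hY⟩
    refine ⟨p g, hgH, fun Z hZ hle => ?_⟩
    obtain ⟨g', hg', rfl⟩ := hH hZ
    exact hpmono.2 (hmin ⟨hg', hZ⟩ (hpmono.1 hle))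
  have hS'univ : Set.univ ∈ p '' S := ⟨Set.univ, huniv, rfl⟩
  let L := BooleanSubalgebra.closure (generatingFamily (p '' S) A)
  have hfin : ∀ F : Set (T × M), F.Finite → F ∈ L := fun F hF =>
    finite_mem_closure_generatingFamily hF
  refine ⟨L, inferInstance, superatomic_closure (infClosed_generatingFamily hS'inf hAA)
    (.inr (.inl hS'univ)) (isWF_generatingFamily hS'inf hS'wf hAA), ?_, ?_, ?_, ?_⟩
  · apply le_antisymm
    · exact (mk_booleanSubalgebra_closure_le _).trans (max_le (mk_generatingFamily_le
        (hlam.trans hχ) (hXle.trans hχ) (Cardinal.mk_image_le.trans hS.le) (hι.trans hχ))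
        (hlam.trans hχ))
    · rw [← hS, ← Cardinal.mk_image_eq hpinj]
      exact Cardinal.mk_le_mk_of_subset
        fun Y hY => BooleanSubalgebra.subset_closure (.inr (.inl hY))
  · rw [mk_atoms_eq hfin, hX]
  · rw [← hX]
    exact mk_le_mk_orderIso hfin
  · refine (mk_orderIso_le (M := M) hfin fun φ π hπ => ?_).trans hpairs
    by_contra! hle
    obtain ⟨d, hd, hdisj⟩ := exists_disjoint_image_of_le_mk_support π hle
    have he : Function.Injective (π ∘ d) := π.injective.comp hd
    obtain ⟨i, N, hN, hAi, hAj⟩ := hdiag d (π ∘ d) hd he hdisj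
    have hmem : (π ∘ d) '' N ∈ L := by
      rw [Set.image_comp, ← hAi]
      exact hπ ⟨A i, mem_closure_generatingFamily hS'univ i⟩ ▸ Subtype.prop _
    have hcount : ((π ∘ d) '' N).Countable := by
      rw [Set.image_comp, ← hAi]
      exact (hAc i).image π
    obtain ⟨s, hs, hdiff⟩ := exists_finite_diff_of_countable (D := D)
      (by rintro _ ⟨g, -, rfl⟩; exact ⟨g, rfl⟩) hD hAc hmem hcount
    refine hN.image he.injOn ((hdiff.union (hs.biUnion fun j _ => hAj j)).subset fun x hx => ?_)
    by_cases hxs : x ∈ ⋃ j ∈ s, A j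
    · obtain ⟨j, hj, hxj⟩ := Set.mem_iUnion₂.1 hxs
      exact .inr (Set.mem_iUnion₂.2 ⟨j, hj, hx, hxj⟩)
    · exact .inl ⟨hx, hxs⟩

/-- If `μ` is strong limit singular of countable cofinality, `λ = 2^μ`, `κ ≤ λ`, and `T` is a
tree with a root, `κ` levels, at most `λ` nodes and `χ > λ` many `κ`-branches, then there is a
superatomic Boolean algebra `B` with `|B| = χ` and `|T| + μ = |Atom(B)| ≤ |Aut(B)| ≤ λ`. -/
theorem exists_superatomic_of_tree (μ lam κ χ : Cardinal)
    (hsl : μ.IsStrongLimit) (hsing : ℵ₀ < μ) (hcf : μ.ord.cof = ℵ₀)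
    (hlam : lam = (2 : Cardinal) ^ μ) (hκ : κ ≤ lam)
    (T : Type) [PartialOrder T] (hT : IsTreeWithLevels T κ) (hTcard : #T ≤ lam)
    (hχ : χ = #{b : Set T // IsKappaBranch T κ b}) (hχlam : lam < χ) :
    ∃ (B : Type) (_ : BooleanAlgebra B), Superatomic B ∧
      #B = χ ∧ #{a : B // IsAtom a} = #T + μ ∧
      #T + μ ≤ #(B ≃o B) ∧ #(B ≃o B) ≤ lam := by
  have hlaminf : ℵ₀ ≤ lam := hlam ▸ hsing.le.trans (Cardinal.cantor μ).le
  have hTinf : Infinite T := by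
    by_contra hfin
    rw [not_infinite_iff_finite] at hfin
    have h : #{b : Set T // IsKappaBranch T κ b} < ℵ₀ := Cardinal.lt_aleph0_of_finite _
    exact (hlaminf.trans_lt (hχlam.trans_eq hχ)).not_gt h
  obtain ⟨S, hinf, huniv, hwf, hS⟩ := exists_wellFounded_infClosed_family hT hχ
    (hTcard.trans hχlam.le) (hlaminf.trans hχlam.le)
  subst hlam
  exact exists_superatomic_of_family hsl hsing hcf hTcard hχlam.le hinf huniv hwf hS
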